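/- arXiv:1706.03369 — 2 statements merged into one kernel-verified Lean document; each statement's English description precedes it below -/
import Mathlib

section
/- The bilinear generating function (Mehler formula) for Hermite polynomials: for |t| < 1/2 and all real x, z, Σ_{j=0}^∞ (tʲ/j!) H_j(x) H_j(z) = (1 − 4t²)^{−1/2} exp(x² − (x − 2zt)²/(1 − 4t²)), where H_j are the (physicists') Hermite polynomials. -/
open Real

/-- Physicists' Hermite polynomial `H_j(x) = (−1)ʲ e^{x²} (d/dx)ʲ e^{−x²}` (Rodrigues). -/
noncomputable def physHermite (j : ℕ) (x : ℝ) : ℝ :=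
  (-1 : ℝ) ^ j * Real.exp (x ^ 2) * iteratedDeriv j (fun y => Real.exp (-y ^ 2)) x

/-- Leibniz rule for multiplication by the variable. -/
lemma itd_id_mul {𝕜 : Type*} [NontriviallyNormedField 𝕜] {g : 𝕜 → 𝕜} {x : 𝕜} (n : ℕ)
    (hg : ContDiffAt 𝕜 n g x) :
    iteratedDeriv n (fun y => y * g y) x =
      x * iteratedDeriv n g x + n * iteratedDeriv (n - 1) g x := by
  rw [iteratedDeriv_fun_mul (contDiffAt_fun_id) hg]
  rcases n with _ | n
  · simp
  · rw [Finset.sum_range_succ', Finset.sum_range_succ']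
    have h2 : ∀ i : ℕ, iteratedDeriv (i + 1 + 1) (fun y : 𝕜 => y) x = 0 := by
      intro i
      rw [iteratedDeriv_succ', iteratedDeriv_succ']
      have : deriv (deriv (fun y : 𝕜 => y)) = fun _ => 0 := by
        have h1 : deriv (fun y : 𝕜 => y) = fun _ => 1 := by ext y; simp
        rw [h1]; ext y; simp
      rw [this]
      simp
    simp [h2]
    ring

lemma phys_zero (x : ℝ) : physHermite 0 x = 1 := by
  simp [physHermite, ← Real.exp_add]

lemma gauss_deriv : deriv (fun y : ℝ => Real.exp (-y ^ 2)) =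
    fun y => (-2) * (y * Real.exp (-y ^ 2)) := by
  ext y
  have h : HasDerivAt (fun y : ℝ => Real.exp (-y ^ 2)) _ y := ((hasDerivAt_pow 2 y).neg).exp
  rw [h.deriv]
  simp
  ring

lemma phys_succ (n : ℕ) (x : ℝ) :
    physHermite (n + 1) x = 2 * x * physHermite n x - 2 * n * physHermite (n - 1) x := by
  unfold physHermite
  rw [iteratedDeriv_succ', gauss_deriv, iteratedDeriv_const_mul_field,
    itd_id_mul n (by fun_prop)]
  rcases n with _ | n
  · simp; ring
  · simp only [Nat.add_sub_cancel]
    push_cast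
    ring

/-- The right-hand side as a holomorphic function of `t`. -/
noncomputable def mehF (x z t : ℂ) : ℂ :=
  (1 - 4 * t ^ 2) ^ (-(1 : ℂ) / 2) * Complex.exp (x ^ 2 - (x - 2 * z * t) ^ 2 / (1 - 4 * t ^ 2))

lemma meh_slit {t : ℂ} (ht : t ∈ Metric.ball (0 : ℂ) (1 / 2)) :
    1 - 4 * t ^ 2 ∈ Complex.slitPlane := by
  have h : ‖t‖ < 1 / 2 := by simpa using ht
  left
  have h1 : (4 * t ^ 2).re ≤ ‖4 * t ^ 2‖ := Complex.re_le_norm _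
  have h2 : ‖4 * t ^ 2‖ = 4 * ‖t‖ ^ 2 := by simp
  have h3 : 0 ≤ ‖t‖ := norm_nonneg t
  rw [Complex.sub_re, Complex.one_re]
  nlinarith

lemma meh_deriv (x z : ℂ) {t : ℂ} (ht : t ∈ Metric.ball (0 : ℂ) (1 / 2)) :
    HasDerivAt (mehF x z)
      ((4 * x * z + (4 - 8 * (x ^ 2 + z ^ 2)) * t + 16 * x * z * t ^ 2 - 16 * t ^ 3) /
        (1 - 4 * t ^ 2) ^ 2 * mehF x z t) t := by
  have hs := meh_slit ht
  have h0 := Complex.slitPlane_ne_zero hs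
  have hu : HasDerivAt (fun t : ℂ => 1 - 4 * t ^ 2) (-(4 * (2 * t))) t := by
    simpa using ((hasDerivAt_pow 2 t).const_mul (4 : ℂ)).const_sub 1
  have hv : HasDerivAt (fun t : ℂ => x - 2 * z * t) (-(2 * z)) t := by
    simpa using ((hasDerivAt_id t).const_mul (2 * z)).const_sub x
  have hE := ((((hv.pow 2).div hu h0).const_sub (x ^ 2)).cexp)
  have hF := (hu.cpow_const (c := -(1 : ℂ) / 2) hs).mul hE
  refine hF.congr_deriv ?_
  have hp : (1 - 4 * t ^ 2) ^ (-(1 : ℂ) / 2 - 1) =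
      (1 - 4 * t ^ 2) ^ (-(1 : ℂ) / 2) / (1 - 4 * t ^ 2) := by
    rw [Complex.cpow_sub _ _ h0, Complex.cpow_one]
  simp only [hp, mehF, Pi.div_apply, Pi.pow_apply]
  generalize (1 - 4 * t ^ 2) ^ (-(1 : ℂ) / 2) = A
  generalize Complex.exp (x ^ 2 - (x - 2 * z * t) ^ 2 / (1 - 4 * t ^ 2)) = B
  field_simp
  push_cast
  ring

lemma meh_diffOn (x z : ℂ) : DifferentiableOn ℂ (mehF x z) (Metric.ball 0 (1 / 2)) :=
  fun _ ht => (meh_deriv x z ht).differentiableAt.differentiableWithinAt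

lemma meh_analytic (x z : ℂ) : AnalyticAt ℂ (mehF x z) 0 :=
  (meh_diffOn x z).analyticAt (Metric.isOpen_ball.mem_nhds (by simp))

lemma meh_rec (x z : ℂ) (n : ℕ) :
    iteratedDeriv (n + 1) (mehF x z) 0 =
      8 * (n * ((n - 1 : ℕ) * iteratedDeriv (n - 1 - 1 + 1) (mehF x z) 0))
      - 16 * (n * ((n - 1 : ℕ) * ((n - 1 - 1 : ℕ) * ((n - 1 - 1 - 1 : ℕ) *
          iteratedDeriv (n - 1 - 1 - 1 - 1 + 1) (mehF x z) 0))))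
      + 4 * x * z * iteratedDeriv n (mehF x z) 0
      + (4 - 8 * (x ^ 2 + z ^ 2)) * (n * iteratedDeriv (n - 1) (mehF x z) 0)
      + 16 * x * z * (n * ((n - 1 : ℕ) * iteratedDeriv (n - 1 - 1) (mehF x z) 0))
      - 16 * (n * ((n - 1 : ℕ) * ((n - 1 - 1 : ℕ) *
          iteratedDeriv (n - 1 - 1 - 1) (mehF x z) 0))) := by
  have hF := meh_analytic x z
  have hD := hF.deriv
  set F := mehF x z with hFdef
  have key : ∀ (g : ℂ → ℂ), AnalyticAt ℂ g 0 → ∀ n : ℕ,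
      iteratedDeriv n (fun y => y * g y) 0 = n * iteratedDeriv (n - 1) g 0 := by
    intro g hg n
    rw [itd_id_mul n hg.contDiffAt]
    simp
  have hm : ∀ {g : ℂ → ℂ}, AnalyticAt ℂ g 0 → AnalyticAt ℂ (fun y => y * g y) 0 :=
    fun hg => analyticAt_id.mul hg
  have hc : ∀ {g : ℂ → ℂ} (c : ℂ), AnalyticAt ℂ g 0 → AnalyticAt ℂ (fun y => c * g y) 0 :=
    fun c hg => analyticAt_const.mul hg
  have ev : deriv F =ᶠ[nhds 0] fun t =>
      8 * (t * (t * deriv F t)) - 16 * (t * (t * (t * (t * deriv F t))))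
      + 4 * x * z * F t + (4 - 8 * (x ^ 2 + z ^ 2)) * (t * F t)
      + 16 * x * z * (t * (t * F t)) - 16 * (t * (t * (t * F t))) := by
    filter_upwards [Metric.isOpen_ball.mem_nhds
      (show (0 : ℂ) ∈ Metric.ball (0 : ℂ) (1 / 2) by simp)] with t ht
    have h0 := Complex.slitPlane_ne_zero (meh_slit ht)
    rw [(meh_deriv x z ht).deriv]
    field_simp
    ring
  rw [iteratedDeriv_succ', ev.iteratedDeriv_eq n]
  have a1 := hc 8 (hm (hm hD))
  have a2 := hc 16 (hm (hm (hm (hm hD))))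
  have a3 := hc (4 * x * z) hF
  have a4 := hc (4 - 8 * (x ^ 2 + z ^ 2)) (hm hF)
  have a5 := hc (16 * x * z) (hm (hm hF))
  have a6 := hc 16 (hm (hm (hm hF)))
  rw [iteratedDeriv_fun_sub ((((a1.fun_sub a2).fun_add a3).fun_add a4).fun_add a5).contDiffAt
      a6.contDiffAt,
    iteratedDeriv_fun_add (((a1.fun_sub a2).fun_add a3).fun_add a4).contDiffAt a5.contDiffAt,
    iteratedDeriv_fun_add ((a1.fun_sub a2).fun_add a3).contDiffAt a4.contDiffAt,
    iteratedDeriv_fun_add (a1.fun_sub a2).contDiffAt a3.contDiffAt,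
    iteratedDeriv_fun_sub a1.contDiffAt a2.contDiffAt]
  simp only [iteratedDeriv_const_mul_field]
  rw [key _ (hm hD), key _ hD, key _ (hm (hm (hm hD))), key _ (hm (hm hD)), key _ (hm hD),
    key _ hD, key _ hF, key _ (hm hF), key _ hF, key _ (hm (hm hF)), key _ (hm hF), key _ hF]
  simp only [iteratedDeriv_succ']

lemma meh_coeff (x z : ℝ) (n : ℕ) :
    iteratedDeriv n (mehF x z) 0 = (physHermite n x : ℂ) * physHermite n z := by
  have hr : ∀ (n : ℕ) (x : ℝ), (physHermite (n + 1) x : ℂ) =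
      2 * x * physHermite n x - 2 * n * physHermite (n - 1) x := by
    intro n x
    rw [phys_succ]; push_cast; ring
  have h0 : ∀ x : ℝ, (physHermite 0 x : ℂ) = 1 := by intro x; simp [phys_zero]
  induction n using Nat.strong_induction_on with
  | _ n ih =>
    rcases n with _ | _ | _ | _ | n
    · simp [phys_zero, mehF]
    · rw [meh_rec]
      simp [ih 0, hr 0, h0]
      ring
    · rw [meh_rec]
      simp [ih 0, ih 1, hr 1, hr 0, h0]
      ring
    · rw [meh_rec]
      simp [ih 0, ih 1, ih 2, hr 2, hr 1, hr 0, h0]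
      ring
    · rw [meh_rec _ _ (n + 1 + 1 + 1)]
      simp only [Nat.add_sub_cancel]
      rw [ih (n + 1 + 1 + 1) (by omega), ih (n + 1 + 1) (by omega), ih (n + 1) (by omega)]
      rcases n with _ | n
      · simp [ih 0, hr 3, hr 2, hr 1, hr 0, h0]
        ring
      · simp only [Nat.add_sub_cancel]
        rw [ih (n + 1) (by omega)]
        rw [hr (n + 1 + 1 + 1 + 1), hr (n + 1 + 1 + 1 + 1), hr (n + 1 + 1 + 1), hr (n + 1 + 1 + 1)]
        simp only [Nat.add_sub_cancel]
        rw [hr (n + 1 + 1), hr (n + 1 + 1)]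
        simp only [Nat.add_sub_cancel]
        push_cast
        ring

/-- Mehler's bilinear generating function for the physicists' Hermite
polynomials: for `|t| < 1/2` and all real `x, z`,
`Σⱼ (tʲ/j!) Hⱼ(x) Hⱼ(z) = (1 − 4t²)^{−1/2} exp(x² − (x − 2zt)²/(1 − 4t²))`. -/
theorem mehler_formula (t x z : ℝ) (ht : |t| < 1 / 2) :
    ∑' j : ℕ, t ^ j / (j.factorial : ℝ) * physHermite j x * physHermite j z =
      (1 - 4 * t ^ 2) ^ (-(1 : ℝ) / 2) *
        Real.exp (x ^ 2 - (x - 2 * z * t) ^ 2 / (1 - 4 * t ^ 2)) := by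
  have hb : (t : ℂ) ∈ Metric.ball (0 : ℂ) (1 / 2) := by simpa using ht
  have hpos : 0 ≤ 1 - 4 * t ^ 2 := by
    have := abs_lt.mp ht
    nlinarith
  have hT := Complex.taylorSeries_eq_on_ball' hb (meh_diffOn (x : ℂ) z)
  apply Complex.ofReal_injective
  rw [Complex.ofReal_tsum, Complex.ofReal_mul, Complex.ofReal_cpow hpos]
  have hR : mehF x z t = ((1 - 4 * t ^ 2 : ℝ) : ℂ) ^ ((-(1 : ℝ) / 2 : ℝ) : ℂ) *
      ((Real.exp (x ^ 2 - (x - 2 * z * t) ^ 2 / (1 - 4 * t ^ 2)) : ℝ) : ℂ) := by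
    simp [mehF]
  rw [← hR, ← hT]
  refine tsum_congr fun j => ?_
  rw [meh_coeff]
  push_cast
  rw [sub_zero]
  ring
end

section
/- For the Gaussian kernel k(x,y) = exp(−(x−y)²/ℓ²) on ℝ and Π = N(0,σ²), with β = 4σ²/ℓ², the functions e_j(x) = ((1+2β)^{1/8}/√(2ʲ j!)) exp(−(x²/(2σ²))·(√(1+2β)−1)/2) H_j((1/4 + β/2)^{1/4} x/σ) satisfy Σ e_j(x) = μ_j e_j(x) where (Σf)(x) = ∫ f(y) k(x,y) dΠ(y) and μ_j = √(2/(1+β+√(1+2β))) · (β/(1+β+√(1+2β)))ʲ. -/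
open Real MeasureTheory

/-- Polynomial form of the physicists' Hermite polynomials. -/
noncomputable def hermP : ℕ → Polynomial ℝ
  | 0 => 1
  | (j + 1) => 2 * Polynomial.X * hermP j - Polynomial.derivative (hermP j)

theorem hermP_deriv (j : ℕ) :
    Polynomial.derivative (hermP (j + 1)) = 2 * ((j : Polynomial ℝ) + 1) * hermP j := by
  induction j with
  | zero => simp [hermP]
  | succ j ih =>
    rw [hermP, Polynomial.derivative_sub, ih]
    have h : Polynomial.derivative (2 * ((j : Polynomial ℝ) + 1) * hermP j)
        = 2 * ((j : Polynomial ℝ) + 1) * Polynomial.derivative (hermP j) := by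
      simp [Polynomial.derivative_mul]
    have h2 : Polynomial.derivative (2 * Polynomial.X * hermP (j + 1))
        = 2 * hermP (j + 1) + 2 * Polynomial.X * Polynomial.derivative (hermP (j + 1)) := by
      simp [Polynomial.derivative_mul]
    rw [h, h2, ih]
    have h3 : hermP (j + 1) = 2 * Polynomial.X * hermP j - Polynomial.derivative (hermP j) := rfl
    rw [h3]
    push_cast
    ring

theorem physHermite_eq (j : ℕ) (x : ℝ) : physHermite j x = (hermP j).eval x := by
  have key : ∀ j : ℕ, iteratedDeriv j (fun y : ℝ => Real.exp (-y ^ 2))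
      = fun x => (-1 : ℝ) ^ j * (hermP j).eval x * Real.exp (-x ^ 2) := by
    intro j
    induction j with
    | zero => ext x; simp [hermP]
    | succ j ih =>
      ext x
      rw [iteratedDeriv_succ, ih]
      have h1 : HasDerivAt (fun x : ℝ => Real.exp (-x ^ 2)) (Real.exp (-x ^ 2) * (-(2 * x))) x := by
        have := ((hasDerivAt_pow 2 x).neg).exp
        simpa using this
      have h2 := (((hermP j).hasDerivAt x).const_mul ((-1 : ℝ) ^ j)).mul h1
      have h3 := h2.deriv
      refine Eq.trans h3 ?_
      simp [hermP, pow_succ]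
      ring
  rw [physHermite, key]
  have h : Real.exp (x ^ 2) * Real.exp (-x ^ 2) = 1 := by
    rw [← Real.exp_add]; simp
  have h' : ((-1 : ℝ) ^ j) * (-1) ^ j = 1 := by
    rw [← mul_pow]; simp
  calc _ = ((-1 : ℝ) ^ j * (-1) ^ j) * (Real.exp (x ^ 2) * Real.exp (-x ^ 2)) * (hermP j).eval x := by ring
    _ = _ := by rw [h, h']; ring

theorem poly_gauss_integrable0 (A : ℝ) (hA : 0 < A) (p : Polynomial ℝ) :
    Integrable (fun y => p.eval y * Real.exp (-A * y ^ 2)) := by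
  induction p using Polynomial.induction_on' with
  | add p q hp hq =>
    simp only [Polynomial.eval_add, add_mul]
    exact hp.add hq
  | monomial n a =>
    have h := integrable_rpow_mul_exp_neg_mul_sq (s := n) hA (by
      have : (0 : ℝ) ≤ n := Nat.cast_nonneg n
      linarith)
    simp only [Real.rpow_natCast] at h
    simp only [Polynomial.eval_monomial, mul_assoc]
    exact h.const_mul a

theorem gauss_square (A B y : ℝ) (hA : 0 < A) :
    Real.exp (-A * y ^ 2 + B * y)
      = Real.exp (B ^ 2 / (4 * A)) * Real.exp (-A * (y - B / (2 * A)) ^ 2) := by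
  rw [← Real.exp_add]
  congr 1
  field_simp
  ring

theorem poly_gauss_integrable (A B : ℝ) (hA : 0 < A) (p : Polynomial ℝ) :
    Integrable (fun y => p.eval y * Real.exp (-A * y ^ 2 + B * y)) := by
  have h := ((poly_gauss_integrable0 A hA
    (p.comp (Polynomial.X + Polynomial.C (B / (2 * A))))).comp_sub_right
      (B / (2 * A))).const_mul (Real.exp (B ^ 2 / (4 * A)))
  refine h.congr (Filter.Eventually.of_forall fun y => ?_)
  simp only [gauss_square A B y hA]
  simp
  ring

theorem gauss_int (A B : ℝ) (hA : 0 < A) :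
    ∫ y, Real.exp (-A * y ^ 2 + B * y) = Real.sqrt (π / A) * Real.exp (B ^ 2 / (4 * A)) := by
  simp_rw [gauss_square A B _ hA]
  rw [integral_const_mul, integral_sub_right_eq_self (fun y => Real.exp (-A * y ^ 2)),
    integral_gaussian]
  ring

/-- The integral of a Hermite polynomial against a shifted Gaussian. -/
noncomputable def hermF (A c B : ℝ) (j : ℕ) : ℝ :=
  ∫ y, (hermP j).eval (c * y) * Real.exp (-A * y ^ 2 + B * y)

theorem poly_gauss_integrable' (A B c : ℝ) (hA : 0 < A) (p : Polynomial ℝ) :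
    Integrable (fun y => p.eval (c * y) * Real.exp (-A * y ^ 2 + B * y)) := by
  have h := poly_gauss_integrable A B hA (p.comp (Polynomial.C c * Polynomial.X))
  simp only [Polynomial.eval_comp, Polynomial.eval_mul, Polynomial.eval_C, Polynomial.eval_X] at h
  exact h

theorem ibp (A B c : ℝ) (hA : 0 < A) (p : Polynomial ℝ) :
    ∫ y, (c * (Polynomial.derivative p).eval (c * y) + p.eval (c * y) * (-(2 * A * y) + B))
      * Real.exp (-A * y ^ 2 + B * y) = 0 := by
  have hint := poly_gauss_integrable A B hA
    (Polynomial.C c * (Polynomial.derivative p).comp (Polynomial.C c * Polynomial.X)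
      + p.comp (Polynomial.C c * Polynomial.X) *
        (-(Polynomial.C (2 * A) * Polynomial.X) + Polynomial.C B))
  refine integral_eq_zero_of_hasDerivAt_of_integrable
    (f := fun y => p.eval (c * y) * Real.exp (-A * y ^ 2 + B * y)) ?_ ?_
    (poly_gauss_integrable' A B c hA p)
  · intro y
    have h1 : HasDerivAt (fun y => p.eval (c * y))
        ((Polynomial.derivative p).eval (c * y) * (c * 1)) y :=
      (p.hasDerivAt (c * y)).comp y ((hasDerivAt_id y).const_mul c)
    have h2 : HasDerivAt (fun y : ℝ => Real.exp (-A * y ^ 2 + B * y)) _ y :=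
      (((hasDerivAt_pow 2 y).const_mul (-A)).add ((hasDerivAt_id y).const_mul B)).exp
    refine (h1.mul h2).congr_deriv ?_
    simp
    ring
  · refine hint.congr (Filter.Eventually.of_forall fun y => ?_)
    simp

theorem hermF_zero (A B c : ℝ) (hA : 0 < A) :
    hermF A c B 0 = Real.sqrt (π / A) * Real.exp (B ^ 2 / (4 * A)) := by
  simp only [hermF, hermP, Polynomial.eval_one, one_mul]
  exact gauss_int A B hA

theorem hermF_one (A B c : ℝ) (hA : 0 < A) :
    hermF A c B 1 = c * B / A * hermF A c B 0 := by
  have h := ibp A B c hA 1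
  have i0 := poly_gauss_integrable' A B c hA (hermP 0)
  have i1 := poly_gauss_integrable' A B c hA (hermP 1)
  have e : ∀ y, c * ((c * (Polynomial.derivative (1 : Polynomial ℝ)).eval (c * y)
      + (1 : Polynomial ℝ).eval (c * y) * (-(2 * A * y) + B)) * Real.exp (-A * y ^ 2 + B * y))
      = (c * B) * ((hermP 0).eval (c * y) * Real.exp (-A * y ^ 2 + B * y))
        - A * ((hermP 1).eval (c * y) * Real.exp (-A * y ^ 2 + B * y)) := by
    intro y
    simp [hermP]
    ring
  have h' := congrArg (fun t => c * t) h
  beta_reduce at h'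
  rw [← integral_const_mul] at h'
  simp_rw [e] at h'
  rw [integral_sub (i0.const_mul _) (i1.const_mul _), integral_const_mul,
    integral_const_mul] at h'
  change c * B * hermF A c B 0 - A * hermF A c B 1 = _ at h'
  field_simp
  linarith

theorem hermF_rec (A B c : ℝ) (hA : 0 < A) (j : ℕ) :
    A * hermF A c B (j + 2) = c * B * hermF A c B (j + 1)
      - 2 * ((j : ℝ) + 1) * (A - c ^ 2) * hermF A c B j := by
  have h := ibp A B c hA (hermP (j + 1))
  have i0 := poly_gauss_integrable' A B c hA (hermP j)
  have i1 := poly_gauss_integrable' A B c hA (hermP (j + 1))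
  have i2 := poly_gauss_integrable' A B c hA (hermP (j + 2))
  have e : ∀ y, c * ((c * (Polynomial.derivative (hermP (j + 1))).eval (c * y)
      + (hermP (j + 1)).eval (c * y) * (-(2 * A * y) + B)) * Real.exp (-A * y ^ 2 + B * y))
      = ((c * B) * ((hermP (j + 1)).eval (c * y) * Real.exp (-A * y ^ 2 + B * y))
        - (2 * ((j : ℝ) + 1) * (A - c ^ 2)) *
          ((hermP j).eval (c * y) * Real.exp (-A * y ^ 2 + B * y)))
        - A * ((hermP (j + 2)).eval (c * y) * Real.exp (-A * y ^ 2 + B * y)) := by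
    intro y
    rw [show hermP (j + 2) = 2 * Polynomial.X * hermP (j + 1)
      - Polynomial.derivative (hermP (j + 1)) from rfl, hermP_deriv]
    simp
    ring
  have h' := congrArg (fun t => c * t) h
  beta_reduce at h'
  rw [← integral_const_mul] at h'
  simp_rw [e] at h'
  have i3 : Integrable (fun y =>
      (c * B) * ((hermP (j + 1)).eval (c * y) * Real.exp (-A * y ^ 2 + B * y))
        - (2 * ((j : ℝ) + 1) * (A - c ^ 2)) *
          ((hermP j).eval (c * y) * Real.exp (-A * y ^ 2 + B * y))) :=
    (i1.const_mul _).sub (i0.const_mul _)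
  rw [integral_sub i3 (i2.const_mul _),
    integral_sub (i1.const_mul _) (i0.const_mul _), integral_const_mul,
    integral_const_mul, integral_const_mul] at h'
  change c * B * hermF A c B (j + 1) - 2 * ((j : ℝ) + 1) * (A - c ^ 2) * hermF A c B j
    - A * hermF A c B (j + 2) = _ at h'
  linarith

theorem hermF_eq (A c E x : ℝ) (hA : 0 < A) (h : (A - c ^ 2) * A = E ^ 2) (j : ℕ) :
    hermF A c (2 * E * x) j = Real.sqrt (π / A) * Real.exp (E ^ 2 * x ^ 2 / A)
      * (E / A) ^ j * (hermP j).eval (c * x) := by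
  have h0 : hermF A c (2 * E * x) 0 = Real.sqrt (π / A) * Real.exp (E ^ 2 * x ^ 2 / A) := by
    rw [hermF_zero A _ c hA]
    congr 2
    field_simp
    ring
  suffices H : ∀ j, hermF A c (2 * E * x) j = Real.sqrt (π / A) * Real.exp (E ^ 2 * x ^ 2 / A)
      * (E / A) ^ j * (hermP j).eval (c * x) ∧
      hermF A c (2 * E * x) (j + 1) = Real.sqrt (π / A) * Real.exp (E ^ 2 * x ^ 2 / A)
      * (E / A) ^ (j + 1) * (hermP (j + 1)).eval (c * x) from (H j).1
  intro j
  induction j with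
  | zero =>
    refine ⟨by rw [h0]; simp [hermP], ?_⟩
    rw [hermF_one A _ c hA, h0]
    simp [hermP]
    ring
  | succ j ih =>
    refine ⟨ih.2, ?_⟩
    have hr := hermF_rec A (2 * E * x) c hA j
    rw [ih.1, ih.2] at hr
    have hAc : A - c ^ 2 = A * (E / A) ^ 2 := by
      field_simp
      linarith
    have hE : E = A * (E / A) := by field_simp
    rw [hAc] at hr
    apply mul_left_cancel₀ hA.ne'
    rw [hr, show hermP (j + 1 + 1) = 2 * Polynomial.X * hermP (j + 1)
      - Polynomial.derivative (hermP (j + 1)) from rfl, hermP_deriv]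
    generalize Real.exp (E ^ 2 * x ^ 2 / A) = Q
    generalize Real.sqrt (π / A) = R
    generalize E / A = r at hE
    rw [hE]
    simp
    ring

/-- eigendecomposition of the Gaussian-kernel integral operator under a
centred Gaussian measure `N(0,σ²)` (Shi et al.).  With `β = 4σ²/ℓ²`,
`e_j(x) = ((1+2β)^{1/8}/√(2ʲ j!)) exp(−(x²/(2σ²))·(√(1+2β)−1)/2) H_j((1/4+β/2)^{1/4} x/σ)`
satisfies `(Σ e_j)(x) = μ_j e_j(x)` where `(Σf)(x) = ∫ f(y) k(x,y) dΠ(y)` and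
`μ_j = √(2/(1+β+√(1+2β))) (β/(1+β+√(1+2β)))ʲ`. -/
theorem gaussian_kernel_eigendecomposition
    (σ ℓ : ℝ) (hσ : 0 < σ) (hℓ : 0 < ℓ)
    (β : ℝ) (hβ : β = 4 * σ ^ 2 / ℓ ^ 2)
    (e : ℕ → ℝ → ℝ)
    (he : ∀ j x, e j x =
      (1 + 2 * β) ^ ((1 : ℝ) / 8) / Real.sqrt (2 ^ j * (j.factorial : ℝ)) *
        Real.exp (-(x ^ 2 / (2 * σ ^ 2)) * (Real.sqrt (1 + 2 * β) - 1) / 2) *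
        physHermite j (((1 : ℝ) / 4 + β / 2) ^ ((1 : ℝ) / 4) * x / σ))
    (μ : ℕ → ℝ)
    (hμ : ∀ j, μ j = Real.sqrt (2 / (1 + β + Real.sqrt (1 + 2 * β))) *
      (β / (1 + β + Real.sqrt (1 + 2 * β))) ^ j) :
    ∀ (j : ℕ) (x : ℝ),
      (∫ y, e j y * Real.exp (-(x - y) ^ 2 / ℓ ^ 2) *
          ((σ * Real.sqrt (2 * Real.pi))⁻¹ * Real.exp (-y ^ 2 / (2 * σ ^ 2)))) =
        μ j * e j x := by
  intro j x
  have hβ0 : 0 < β := by rw [hβ]; positivity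
  obtain ⟨s, hs⟩ : ∃ s, s = Real.sqrt (1 + 2 * β) := ⟨_, rfl⟩
  have hs0 : 0 < s := by rw [hs]; exact Real.sqrt_pos.2 (by linarith)
  have hs2 : s ^ 2 = 1 + 2 * β := by rw [hs]; exact Real.sq_sqrt (by linarith)
  obtain ⟨c, hc⟩ : ∃ c, c = ((1 : ℝ) / 4 + β / 2) ^ ((1 : ℝ) / 4) / σ := ⟨_, rfl⟩
  have hc2 : c ^ 2 = s / (2 * σ ^ 2) := by
    have : (((1 : ℝ) / 4 + β / 2) ^ ((1 : ℝ) / 4)) ^ 2 = s / 2 := by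
      rw [← Real.rpow_natCast, ← Real.rpow_mul (by linarith)]
      rw [show (1 : ℝ) / 4 * (2 : ℕ) = 1 / 2 by norm_num, ← Real.sqrt_eq_rpow]
      rw [Real.sqrt_eq_iff_eq_sq (by linarith) (by linarith)]
      rw [div_pow, hs2]; ring
    rw [hc, div_pow, this]
    field_simp
  obtain ⟨A, hA⟩ : ∃ A, A = (1 + β + s) / (4 * σ ^ 2) := ⟨_, rfl⟩
  obtain ⟨E, hE⟩ : ∃ E, E = β / (4 * σ ^ 2) := ⟨_, rfl⟩
  have hA0 : 0 < A := by rw [hA]; positivity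
  have hEl : E = 1 / ℓ ^ 2 := by rw [hE, hβ]; field_simp
  have hAE : (A - c ^ 2) * A = E ^ 2 := by
    rw [hc2, hA, hE]
    field_simp
    linear_combination (-2) * hs2
  have main := hermF_eq A c E x hA0 hAE j
  have hEA : E / A = β / (1 + β + s) := by
    rw [hE, hA]; field_simp
  have hconst : (σ * Real.sqrt (2 * π))⁻¹ * Real.sqrt (π / A) = Real.sqrt (2 / (1 + β + s)) := by
    have hσ' : σ = Real.sqrt (σ ^ 2) := (Real.sqrt_sq hσ.le).symm
    nth_rewrite 1 [hσ']
    rw [← Real.sqrt_mul (by positivity), ← Real.sqrt_inv, ← Real.sqrt_mul (by positivity)]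
    congr 1
    rw [hA]
    field_simp
    ring
  have hexp : Real.exp (-(E * x ^ 2)) * Real.exp (E ^ 2 * x ^ 2 / A)
      = Real.exp (-(x ^ 2 / (2 * σ ^ 2)) * (s - 1) / 2) := by
    rw [← Real.exp_add]
    congr 1
    rw [hE, hA]
    field_simp
    linear_combination (4 * x ^ 2) * hs2
  obtain ⟨K, hK⟩ : ∃ K, K = (1 + 2 * β) ^ ((1 : ℝ) / 8) / Real.sqrt (2 ^ j * (j.factorial : ℝ)) :=
    ⟨_, rfl⟩
  have he' : ∀ y, e j y = K * Real.exp (-(y ^ 2 / (2 * σ ^ 2)) * (s - 1) / 2)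
      * (hermP j).eval (c * y) := by
    intro y
    rw [he, physHermite_eq, ← hs, ← hK, hc]
    congr 2
    ring
  have hin : ∀ y, e j y * Real.exp (-(x - y) ^ 2 / ℓ ^ 2) *
          ((σ * Real.sqrt (2 * Real.pi))⁻¹ * Real.exp (-y ^ 2 / (2 * σ ^ 2)))
      = (K * (σ * Real.sqrt (2 * Real.pi))⁻¹ * Real.exp (-(E * x ^ 2))) *
        ((hermP j).eval (c * y) * Real.exp (-A * y ^ 2 + 2 * E * x * y)) := by
    intro y
    have hx : Real.exp (-(y ^ 2 / (2 * σ ^ 2)) * (s - 1) / 2) * Real.exp (-(x - y) ^ 2 / ℓ ^ 2)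
        * Real.exp (-y ^ 2 / (2 * σ ^ 2))
        = Real.exp (-(E * x ^ 2)) * Real.exp (-A * y ^ 2 + 2 * E * x * y) := by
      rw [← Real.exp_add, ← Real.exp_add, ← Real.exp_add]
      congr 1
      have : -(x - y) ^ 2 / ℓ ^ 2 = -(x - y) ^ 2 * E := by rw [hEl]; ring
      rw [this, hA, hE]
      field_simp
      ring
    rw [he']
    linear_combination (K * (σ * Real.sqrt (2 * Real.pi))⁻¹ * (hermP j).eval (c * y)) * hx
  simp_rw [hin]
  rw [integral_const_mul]
  change _ * hermF A c (2 * E * x) j = _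
  rw [main, hμ, he', ← hs, ← hexp, ← hconst, hEA]
  ring
end
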